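/- Let K ⊆ L be a field extension such that the number of K-automorphisms of L equals the degree [L : K], and put T = K + X·L[X]. If T is a Noetherian ring, then K ⊆ L is a Galois extension (normal and separable). -/

import Mathlib

/-- The polynomial composite `K + X·L[X]`: the subring of `L[X]` consisting of
all polynomials whose constant term lies in (the image of) `K`. -/
def polynomialComposite (K L : Type*) [Field K] [Field L] [Algebra K L] :
    Subring (Polynomial L) where
  carrier := {p | p.coeff 0 ∈ (algebraMap K L).range}
  mul_mem' := by
    intro a b ha hb
    simp only [Set.mem_setOf_eq, Polynomial.mul_coeff_zero] at *
    exact mul_mem ha hb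
  one_mem' := by simp
  add_mem' := by
    intro a b ha hb
    simp only [Set.mem_setOf_eq, Polynomial.coeff_add] at *
    exact add_mem ha hb
  zero_mem' := by simp
  neg_mem' := by
    intro a ha
    simp only [Set.mem_setOf_eq, Polynomial.coeff_neg] at *
    exact neg_mem ha


/-- If `K + X·L[X]` is Noetherian, the linear coefficients of generators of the ideal `X·L[X]`
span `L` over `K`. -/
theorem finiteDimensional_of_isNoetherianRing_polynomialComposite
    (K L : Type*) [Field K] [Field L] [Algebra K L]
    [IsNoetherianRing (polynomialComposite K L)] :
    FiniteDimensional K L := by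
  let I : Ideal (polynomialComposite K L) :=
    RingHom.ker (Polynomial.constantCoeff.comp (polynomialComposite K L).subtype)
  have mem_I (x : polynomialComposite K L) : x ∈ I ↔ x.1.coeff 0 = 0 := Iff.rfl
  obtain ⟨s, hs⟩ := IsNoetherian.noetherian I
  classical
  refine ⟨⟨s.image fun p => p.1.coeff 1, eq_top_iff.2 fun a _ => ?_⟩⟩
  have linearCoeff_mem : ∀ x : polynomialComposite K L,
      x ∈ Submodule.span (polynomialComposite K L) (s : Set (polynomialComposite K L)) →
      x.1.coeff 1 ∈ Submodule.span K
        ((s.image fun p => p.1.coeff 1 : Finset L) : Set L) := by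
    intro x hx
    induction hx using Submodule.span_induction with
    | mem x hx => exact Submodule.subset_span (Finset.mem_coe.2 (Finset.mem_image_of_mem _ hx))
    | zero => simp
    | add x y _ _ hx hy => simpa using add_mem hx hy
    | smul t x hx hx' =>
      have hx0 : x.1.coeff 0 = 0 := (mem_I x).1 (hs ▸ hx)
      obtain ⟨k, hk⟩ := t.2
      have : (t • x).1.coeff 1 = k • x.1.coeff 1 := by
        simp [Polynomial.mul_coeff_one, hx0, Algebra.smul_def, hk]
      rw [this]
      exact Submodule.smul_mem _ k hx'
  have hX : Polynomial.C a * Polynomial.X ∈ polynomialComposite K L :=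
    ⟨0, by simp⟩
  have hXI : (⟨_, hX⟩ : polynomialComposite K L) ∈ I := (mem_I _).2 (by simp)
  have ha : (Polynomial.C a * Polynomial.X).coeff 1 = a := by simp
  rw [← ha]
  exact linearCoeff_mem _ (hs.symm ▸ hXI)

theorem galois_of_composite_noetherian_of_card_aut
    (K L : Type*) [Field K] [Field L] [Algebra K L]
    (hcard : Nat.card (L ≃ₐ[K] L) = Module.finrank K L)
    (hT : IsNoetherianRing (polynomialComposite K L)) :
    IsGalois K L := by
  have := finiteDimensional_of_isNoetherianRing_polynomialComposite K L
  exact IsGalois.of_card_aut_eq_finrank K L hcard
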